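/- arXiv:math/0703084 — 2 statements merged into one kernel-verified Lean document; each statement's English description precedes it below -/
import Mathlib

section
/- Let b_k > a_k > 0 for k = 1, 2, 3 and 0 < s < 1. Define g((a_3);(b_3);s) = ∫_{Λ_3(s)} [1 − s/(t_2 t_3)]^{b_1−a_1−1} t_2^{a_2−a_1−1} t_3^{a_3−a_1−1} (1−t_2)^{b_2−a_2−1}(1−t_3)^{b_3−a_3−1} dt_2 dt_3, where Λ_3(s) = {(t_2, t_3) ∈ (0,1)² : t_2 t_3 > s}. Then g((a_3);(b_3);s) = [Γ(b_1−a_1)Γ(b_3−a_3)/Γ(b_1+b_3−a_1−a_3)] · s^{a_2−a_1} (1−s)^{b_1+b_2+b_3−a_1−a_2−a_3−1} · ∫_0^1 y^{b_1+b_3−a_1−a_3−1} (1−y)^{b_2−a_2−1} (1 − y(1−s))^{−(b_2−a_3)} ₂F₁(b_3−a_1, b_1−a_1; b_1+b_3−a_1−a_3; y(1−s)) dy. -/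
open MeasureTheory Real

/-- Pochhammer symbol `(a)_n = a(a+1)⋯(a+n−1)`. -/
noncomputable def poch (a : ℝ) (n : ℕ) : ℝ := (ascPochhammer ℝ n).eval a

/-- Gauss hypergeometric series `₂F₁(α, β; γ; y)`. -/
noncomputable def F21 (α β γ y : ℝ) : ℝ :=
  ∑' n : ℕ, poch α n * poch β n / (poch γ n * (n.factorial : ℝ)) * y ^ n

/-- The function `g((a_3);(b_3);s)`: a double integral over
`Λ₃(s) = {(t₂, t₃) ∈ (0,1)² : t₂t₃ > s}`. -/
noncomputable def g3 (a₁ a₂ a₃ b₁ b₂ b₃ s : ℝ) : ℝ :=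
  ∫ p : ℝ × ℝ in
      {p : ℝ × ℝ | p.1 ∈ Set.Ioo (0 : ℝ) 1 ∧ p.2 ∈ Set.Ioo (0 : ℝ) 1 ∧ s < p.1 * p.2},
    (1 - s / (p.1 * p.2)) ^ (b₁ - a₁ - 1) * p.1 ^ (a₂ - a₁ - 1) * p.2 ^ (a₃ - a₁ - 1) *
      (1 - p.1) ^ (b₂ - a₂ - 1) * (1 - p.2) ^ (b₃ - a₃ - 1)


lemma mob_lint (q : ℝ) (h0 : 0 < q) (h1 : q < 1) (g : ℝ → ENNReal) :
    ∫⁻ u in Set.Ioo q 1, g u =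
      ∫⁻ v in Set.Ioo (0:ℝ) 1, ENNReal.ofReal (q * (1 - q) / (1 - (1 - q) * v) ^ 2) *
        g (q / (1 - (1 - q) * v)) := by
  have hw : ∀ v ∈ Set.Ioo (0:ℝ) 1, q < 1 - (1 - q) * v := fun v hv => by
    nlinarith [hv.1, hv.2]
  have himg : (fun v => q / (1 - (1 - q) * v)) '' Set.Ioo (0:ℝ) 1 = Set.Ioo q 1 := by
    ext u
    constructor
    · rintro ⟨v, hv, rfl⟩
      have := hw v hv
      refine ⟨?_, ?_⟩
      · show q < q / _
        rw [lt_div_iff₀ (by linarith)]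
        nlinarith [hv.1, mul_pos h0 (mul_pos (sub_pos.2 h1) hv.1)]
      · show q / _ < 1
        rw [div_lt_one (by linarith)]
        exact this
    · rintro ⟨hu0, hu1⟩
      have hu : 0 < u := h0.trans hu0
      have hq : 0 < 1 - q := by linarith
      refine ⟨(1 - q / u) / (1 - q), ⟨?_, ?_⟩, ?_⟩
      · apply div_pos _ hq
        rw [sub_pos, div_lt_one hu]; exact hu0
      · rw [div_lt_one hq]
        have : q < q / u := by rw [lt_div_iff₀ hu]; nlinarith
        linarith
      · show q / (1 - (1 - q) * ((1 - q / u) / (1 - q))) = u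
        field_simp
        ring_nf
        field_simp
  rw [← himg, lintegral_image_eq_lintegral_abs_deriv_mul measurableSet_Ioo
    (f' := fun v => q * (1 - q) / (1 - (1 - q) * v) ^ 2)]
  · refine setLIntegral_congr_fun measurableSet_Ioo fun v hv => ?_
    have := hw v hv
    have h3 : 0 ≤ q * (1 - q) / (1 - (1 - q) * v) ^ 2 := by
      have : 0 < 1 - q := by linarith
      positivity
    rw [abs_of_nonneg h3]
  · intro v hv
    have := hw v hv
    have hne : 1 - (1 - q) * v ≠ 0 := by linarith
    have h := ((hasDerivAt_const v q).div (((hasDerivAt_id v).const_mul (1 - q)).const_sub 1) hne)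
    have e : q * (1 - q) / (1 - (1 - q) * v) ^ 2 =
        (0 * (1 - (1 - q) * id v) - q * (-((1 - q) * 1))) / (1 - (1 - q) * id v) ^ 2 := by
      simp only [id]; congr 1; ring
    rw [e]
    exact HasDerivAt.hasDerivWithinAt h
  · intro v hv w hw' h
    have h1' := hw v hv
    have h2' := hw w hw'
    beta_reduce at h
    rw [div_eq_div_iff (by linarith) (by linarith)] at h
    have : q * (1 - q) * (v - w) = 0 := by linarith
    rcases mul_eq_zero.1 this with h | h
    · nlinarith
    · linarith

lemma beta_int (A C : ℝ) (hA : 0 < A) (hC : 0 < C) :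
    IntegrableOn (fun v : ℝ => v ^ (A - 1) * (1 - v) ^ (C - 1)) (Set.Ioo (0:ℝ) 1) ∧
    ∫ v in Set.Ioo (0:ℝ) 1, v ^ (A - 1) * (1 - v) ^ (C - 1) =
      Gamma A * Gamma C / Gamma (A + C) := by
  have h := ProbabilityTheory.lintegral_betaPDF_eq_one hA hC
  have hb := ProbabilityTheory.beta_pos hA hC
  rw [ProbabilityTheory.lintegral_betaPDF] at h
  set b := ProbabilityTheory.beta A C with hbdef
  have hm : AEStronglyMeasurable (fun v : ℝ => 1 / b * v ^ (A - 1) * (1 - v) ^ (C - 1))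
      (volume.restrict (Set.Ioo (0:ℝ) 1)) := by
    apply Measurable.aestronglyMeasurable; fun_prop
  have hnn : 0 ≤ᵐ[volume.restrict (Set.Ioo (0:ℝ) 1)]
      (fun v : ℝ => 1 / b * v ^ (A - 1) * (1 - v) ^ (C - 1)) := by
    filter_upwards [ae_restrict_mem measurableSet_Ioo] with v hv
    have := hv.1
    have : 0 < 1 - v := by linarith [hv.2]
    simp only [Pi.zero_apply]
    positivity
  have hi : IntegrableOn (fun v : ℝ => 1 / b * v ^ (A - 1) * (1 - v) ^ (C - 1))
      (Set.Ioo (0:ℝ) 1) := by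
    refine ⟨hm, ?_⟩
    rw [hasFiniteIntegral_iff_ofReal hnn, h]
    simp
  have hI := integral_eq_lintegral_of_nonneg_ae hnn hm
  rw [h] at hI
  have e : (fun v : ℝ => v ^ (A - 1) * (1 - v) ^ (C - 1)) =
      fun v => b * (1 / b * v ^ (A - 1) * (1 - v) ^ (C - 1)) := by
    funext v; field_simp
  rw [e]
  refine ⟨hi.const_mul b, ?_⟩
  rw [integral_const_mul, hI, hbdef]
  simp [ProbabilityTheory.beta]

lemma Gamma_add_poch (A : ℝ) (hA : 0 < A) (n : ℕ) : Gamma (A + n) = poch A n * Gamma A := by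
  induction n with
  | zero => simp [poch]
  | succ n ih =>
    have : A + (n + 1 : ℕ) = (A + n) + 1 := by push_cast; ring
    rw [this, Gamma_add_one (by positivity), ih]
    simp only [poch, ascPochhammer_succ_eval]
    ring

lemma poch_pos (A : ℝ) (hA : 0 < A) (n : ℕ) : 0 < poch A n := by
  rw [poch]; exact ascPochhammer_pos n A hA

lemma choose_poch (a : ℝ) (n : ℕ) : Ring.choose (a + n - 1) n = poch a n / n.factorial := by
  rw [Ring.choose, show a + n - 1 - n + 1 = a by ring]
  have := Ring.factorial_nsmul_multichoose_eq_ascPochhammer a n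
  rw [Polynomial.ascPochhammer_smeval_eq_eval, nsmul_eq_mul] at this
  rw [poch, ← this]
  have : (n.factorial : ℝ) ≠ 0 := by positivity
  field_simp

lemma binom_sum (a x : ℝ) (hx0 : 0 ≤ x) (hx : x < 1) :
    HasSum (fun n : ℕ => poch a n / n.factorial * x ^ n) ((1 - x) ^ (-a)) ∧
    Summable (fun n : ℕ => |poch a n / (n.factorial : ℝ)| * x ^ n) := by
  have h := Real.one_div_one_sub_rpow_hasFPowerSeriesOnBall_zero a
  have hmem : x ∈ Metric.eball (0:ℝ) 1 := by
    simp [Real.enorm_of_nonneg hx0]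
    exact hx
  have h1 := h.hasSum hmem
  have h2 := FormalMultilinearSeries.summable_norm_apply _ (Metric.eball_subset_eball h.r_le hmem)
  simp only [choose_poch, FormalMultilinearSeries.ofScalars_apply_eq] at h1 h2
  constructor
  · have e : (1 - x) ^ (-a) = 1 / (1 - (0 + x)) ^ a := by
      rw [rpow_neg (by linarith)]; simp
    rw [e]
    exact h1
  · refine h2.congr fun n => ?_
    rw [smul_eq_mul, Real.norm_eq_abs, abs_mul, abs_of_nonneg (pow_nonneg hx0 n)]

lemma euler (A C α z : ℝ) (hA : 0 < A) (hC : 0 < C) (hz0 : 0 ≤ z) (hz : z < 1) :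
    IntegrableOn (fun v : ℝ => v ^ (A - 1) * (1 - v) ^ (C - 1) * (1 - z * v) ^ (-α))
      (Set.Ioo (0:ℝ) 1) ∧
    ∫ v in Set.Ioo (0:ℝ) 1, v ^ (A - 1) * (1 - v) ^ (C - 1) * (1 - z * v) ^ (-α) =
      Gamma A * Gamma C / Gamma (A + C) * F21 α A (A + C) z := by
  constructor
  · refine Integrable.mul_bdd (c := max 1 ((1 - z) ^ (-α))) (beta_int A C hA hC).1 ?_ ?_
    · apply Measurable.aestronglyMeasurable; fun_prop
    · filter_upwards [ae_restrict_mem measurableSet_Ioo] with v hv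
      have h1 : z * v ≤ z := by nlinarith [hv.1, hv.2]
      have h0 : 0 ≤ z * v := mul_nonneg hz0 hv.1.le
      have hp : 0 < 1 - z * v := by linarith
      rw [Real.norm_of_nonneg (rpow_nonneg hp.le _)]
      rcases le_total 0 α with h | h
      · apply le_max_of_le_right
        exact rpow_le_rpow_of_nonpos (by linarith) (by linarith) (by linarith)
      · apply le_max_of_le_left
        exact rpow_le_one hp.le (by linarith) (by linarith)
  · set F : ℕ → ℝ → ℝ := fun n v => poch α n / n.factorial * z ^ n *
      (v ^ (A + n - 1) * (1 - v) ^ (C - 1)) with hF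
    have hB := fun n : ℕ => beta_int (A + n) C (by positivity) hC
    have hint : ∀ n, Integrable (F n) (volume.restrict (Set.Ioo (0:ℝ) 1)) := fun n =>
      (hB n).1.const_mul _
    have hsum := (binom_sum α z hz0 hz).2
    have hnorm : ∀ n, ∫ v in Set.Ioo (0:ℝ) 1, ‖F n v‖ =
        |poch α n / (n.factorial : ℝ)| * z ^ n *
          ∫ v in Set.Ioo (0:ℝ) 1, v ^ (A + n - 1) * (1 - v) ^ (C - 1) := by
      intro n
      rw [← integral_const_mul]
      refine setIntegral_congr_fun measurableSet_Ioo fun v hv => ?_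
      have := hv.1
      have : 0 < 1 - v := by linarith [hv.2]
      have hh : 0 ≤ v ^ (A + n - 1) * (1 - v) ^ (C - 1) := by positivity
      simp only [hF, Real.norm_eq_abs]
      rw [abs_mul, abs_mul, abs_of_nonneg hh, abs_of_nonneg (pow_nonneg hz0 n)]
    have hle : ∀ n : ℕ, ∫ v in Set.Ioo (0:ℝ) 1, v ^ (A + n - 1) * (1 - v) ^ (C - 1) ≤
        ∫ v in Set.Ioo (0:ℝ) 1, v ^ (A - 1) * (1 - v) ^ (C - 1) := by
      intro n
      refine setIntegral_mono_on (hB n).1 (beta_int A C hA hC).1 measurableSet_Ioo fun v hv => ?_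
      have h1 := hv.1
      have : 0 < 1 - v := by linarith [hv.2]
      gcongr ?_ * _
      exact rpow_le_rpow_of_exponent_ge h1 hv.2.le (by linarith [(Nat.cast_nonneg n : (0:ℝ) ≤ n)])
    have hS : Summable fun n => ∫ v in Set.Ioo (0:ℝ) 1, ‖F n v‖ := by
      refine Summable.of_nonneg_of_le (fun n => integral_nonneg fun v => norm_nonneg _) (fun n => ?_)
        (hsum.mul_right (∫ v in Set.Ioo (0:ℝ) 1, v ^ (A - 1) * (1 - v) ^ (C - 1)))
      rw [hnorm]
      exact mul_le_mul_of_nonneg_left (hle n) (by positivity)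
    have hm := (hasSum_integral_of_summable_integral_norm hint hS).tsum_eq
    have e1 : ∫ v in Set.Ioo (0:ℝ) 1, v ^ (A - 1) * (1 - v) ^ (C - 1) * (1 - z * v) ^ (-α) =
        ∫ v in Set.Ioo (0:ℝ) 1, ∑' n, F n v := by
      refine setIntegral_congr_fun measurableSet_Ioo fun v hv => ?_
      have h1 : z * v ≤ z := by nlinarith [hv.1, hv.2]
      have h0 : 0 ≤ z * v := mul_nonneg hz0 hv.1.le
      have hb := (binom_sum α (z * v) h0 (by linarith)).1
      beta_reduce
      rw [← hb.tsum_eq, ← tsum_mul_left]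
      refine tsum_congr fun n => ?_
      simp only [hF]
      rw [show A + n - 1 = (A - 1) + n by ring, rpow_add hv.1, rpow_natCast, mul_pow]
      ring
    rw [e1, ← hm, F21, ← tsum_mul_left]
    refine tsum_congr fun n => ?_
    simp only [hF]
    rw [integral_const_mul, (hB n).2, Gamma_add_poch A hA,
      show A + n + C = (A + C) + n by ring, Gamma_add_poch (A + C) (by positivity)]
    have g1 := (Gamma_pos_of_pos (add_pos hA hC)).ne'
    have g2 := (poch_pos (A + C) (by positivity) n).ne'
    have g3 : (n.factorial : ℝ) ≠ 0 := by positivity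
    field_simp

lemma key (a₁ a₂ a₃ b₁ b₂ b₃ s ms y my w v mv x : ℝ) (h1 : 0 < s) (h2 : 0 < ms) (h3 : 0 < y)
    (h4 : 0 < my) (h5 : 0 < w) (h6 : 0 < v) (h7 : 0 < mv) (h8 : 0 < x) :
    s * ms / w ^ 2 * (w * (y * ms) / x ^ 2 * ((y * ms * v) ^ (b₁ - a₁ - 1) *
      (s / w) ^ (a₂ - a₁ - 1) * (w / x) ^ (a₃ - a₁ - 1) *
      (ms * my / w) ^ (b₂ - a₂ - 1) * (y * ms * mv / x) ^ (b₃ - a₃ - 1))) =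
    (s ^ (a₂ - a₁) * ms ^ (b₁ + b₂ + b₃ - a₁ - a₂ - a₃ - 1) *
      (y ^ (b₁ + b₃ - a₁ - a₃ - 1) * my ^ (b₂ - a₂ - 1) * w ^ (-(b₂ - a₃)))) *
    (v ^ (b₁ - a₁ - 1) * mv ^ (b₃ - a₃ - 1) * x ^ (-(b₃ - a₁))) := by
  have E : ∀ t : ℝ, 0 < t → ∃ T, t = exp T := fun t ht => ⟨log t, (exp_log ht).symm⟩
  obtain ⟨s, rfl⟩ := E s h1
  obtain ⟨ms, rfl⟩ := E ms h2
  obtain ⟨y, rfl⟩ := E y h3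
  obtain ⟨my, rfl⟩ := E my h4
  obtain ⟨w, rfl⟩ := E w h5
  obtain ⟨v, rfl⟩ := E v h6
  obtain ⟨mv, rfl⟩ := E mv h7
  obtain ⟨x, rfl⟩ := E x h8
  simp only [← exp_add, ← exp_sub, ← exp_mul, ← exp_nat_mul]
  congr 1
  push_cast
  ring

lemma key2 (a₁ a₂ a₃ b₁ b₂ b₃ s y v : ℝ) (h0 : 0 < s) (h1 : s < 1)
    (hy : y ∈ Set.Ioo (0:ℝ) 1) (hv : v ∈ Set.Ioo (0:ℝ) 1) (t r u : ℝ)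
    (ht : t = s / (1 - (1 - s) * y)) (hr : r = s / t) (hu : u = r / (1 - (1 - r) * v)) :
    s * (1 - s) / (1 - (1 - s) * y) ^ 2 * (r * (1 - r) / (1 - (1 - r) * v) ^ 2 *
      ((1 - s / (t * u)) ^ (b₁ - a₁ - 1) * t ^ (a₂ - a₁ - 1) * u ^ (a₃ - a₁ - 1) *
      (1 - t) ^ (b₂ - a₂ - 1) * (1 - u) ^ (b₃ - a₃ - 1))) =
    (s ^ (a₂ - a₁) * (1 - s) ^ (b₁ + b₂ + b₃ - a₁ - a₂ - a₃ - 1) *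
      (y ^ (b₁ + b₃ - a₁ - a₃ - 1) * (1 - y) ^ (b₂ - a₂ - 1) *
        (1 - y * (1 - s)) ^ (-(b₂ - a₃)))) *
    (v ^ (b₁ - a₁ - 1) * (1 - v) ^ (b₃ - a₃ - 1) * (1 - y * (1 - s) * v) ^ (-(b₃ - a₁))) := by
  obtain ⟨hy0, hy1⟩ := hy
  obtain ⟨hv0, hv1⟩ := hv
  have hms : 0 < 1 - s := by linarith
  have hz : 0 < y * (1 - s) := by positivity
  have hw : 0 < 1 - y * (1 - s) := by nlinarith
  have hx : 0 < 1 - y * (1 - s) * v := by nlinarith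
  have ht' : t = s / (1 - y * (1 - s)) := by rw [ht, mul_comm]
  have hr' : r = 1 - y * (1 - s) := by rw [hr, ht']; field_simp
  have hr1 : 1 - r = y * (1 - s) := by rw [hr']; ring
  rw [hr1] at hu
  have e1 : 1 - s / (t * u) = y * (1 - s) * v := by
    rw [hu, ht', hr']; field_simp; ring
  have e2 : 1 - t = (1 - s) * (1 - y) / (1 - y * (1 - s)) := by
    rw [ht']; field_simp; ring
  have e3 : 1 - u = y * (1 - s) * (1 - v) / (1 - y * (1 - s) * v) := by
    rw [hu, hr']; field_simp; ring
  rw [e1, e2, e3, hr1, hu, ht', hr', mul_comm (1 - s) y]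
  exact key a₁ a₂ a₃ b₁ b₂ b₃ s (1 - s) y (1 - y) _ v (1 - v) _ h0 hms hy0 (by linarith) hw hv0
    (by linarith) hx
/-- Representation of `g((a_3);(b_3);s)` as a single integral of a `₂F₁`. -/
theorem g3_repr (a₁ a₂ a₃ b₁ b₂ b₃ s : ℝ)
    (h₁ : 0 < a₁ ∧ a₁ < b₁) (h₂ : 0 < a₂ ∧ a₂ < b₂) (h₃ : 0 < a₃ ∧ a₃ < b₃)
    (hs0 : 0 < s) (hs1 : s < 1) :
    g3 a₁ a₂ a₃ b₁ b₂ b₃ s =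
      Gamma (b₁ - a₁) * Gamma (b₃ - a₃) / Gamma (b₁ + b₃ - a₁ - a₃) *
        (s ^ (a₂ - a₁) * (1 - s) ^ (b₁ + b₂ + b₃ - a₁ - a₂ - a₃ - 1)) *
        ∫ y in Set.Ioo (0 : ℝ) 1,
          y ^ (b₁ + b₃ - a₁ - a₃ - 1) * (1 - y) ^ (b₂ - a₂ - 1) *
            (1 - y * (1 - s)) ^ (-(b₂ - a₃)) *
            F21 (b₃ - a₁) (b₁ - a₁) (b₁ + b₃ - a₁ - a₃) (y * (1 - s)) := by
  set f : ℝ × ℝ → ℝ := fun p => (1 - s / (p.1 * p.2)) ^ (b₁ - a₁ - 1) * p.1 ^ (a₂ - a₁ - 1) *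
    p.2 ^ (a₃ - a₁ - 1) * (1 - p.1) ^ (b₂ - a₂ - 1) * (1 - p.2) ^ (b₃ - a₃ - 1) with hf
  set S : Set (ℝ × ℝ) :=
    {p : ℝ × ℝ | p.1 ∈ Set.Ioo (0 : ℝ) 1 ∧ p.2 ∈ Set.Ioo (0 : ℝ) 1 ∧ s < p.1 * p.2} with hS
  have hfm : Measurable f := by fun_prop
  have hSm : MeasurableSet S := by
    have : S = (Set.Ioo (0:ℝ) 1 ×ˢ Set.Ioo (0:ℝ) 1) ∩ {p : ℝ × ℝ | s < p.1 * p.2} := by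
      ext p; simp only [hS, Set.mem_ofPred_eq, Set.mem_inter_iff, Set.mem_prod]; tauto
    rw [this]
    exact (measurableSet_Ioo.prod measurableSet_Ioo).inter
      (measurableSet_lt measurable_const (by fun_prop))
  have hms : 0 < 1 - s := by linarith
  have hg : g3 a₁ a₂ a₃ b₁ b₂ b₃ s = (∫⁻ p in S, ENNReal.ofReal (f p)).toReal := by
    rw [g3]
    refine integral_eq_lintegral_of_nonneg_ae ?_ hfm.aestronglyMeasurable
    filter_upwards [ae_restrict_mem hSm] with p hp
    obtain ⟨⟨p1, p2⟩, ⟨p3, p4⟩, p5⟩ := hp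
    have q1 : 0 < 1 - p.1 := by linarith
    have q2 : 0 < 1 - p.2 := by linarith
    have q3 : 0 ≤ 1 - s / (p.1 * p.2) := by
      rw [sub_nonneg, div_le_one (by positivity)]; exact p5.le
    simp only [Pi.zero_apply]
    positivity
  have hL : ∫⁻ p in S, ENNReal.ofReal (f p) =
      ∫⁻ t in Set.Ioo s 1, ∫⁻ u in Set.Ioo (s / t) 1, ENNReal.ofReal (f (t, u)) := by
    rw [← lintegral_indicator hSm, Measure.volume_eq_prod, lintegral_prod _
      (Measurable.aemeasurable (hfm.ennreal_ofReal.indicator hSm)),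
      ← lintegral_indicator measurableSet_Ioo]
    refine lintegral_congr fun t => ?_
    by_cases ht : t ∈ Set.Ioo s 1
    · rw [Set.indicator_of_mem ht, ← lintegral_indicator measurableSet_Ioo]
      refine lintegral_congr fun u => ?_
      have ht0 : 0 < t := hs0.trans ht.1
      have hiff : (t, u) ∈ S ↔ u ∈ Set.Ioo (s / t) 1 := by
        simp only [hS, Set.mem_ofPred_eq, Set.mem_Ioo, div_lt_iff₀ ht0]
        constructor
        · rintro ⟨_, ⟨_, h⟩, h'⟩
          exact ⟨by linarith, h⟩
        · rintro ⟨h, h'⟩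
          refine ⟨⟨ht0, ht.2⟩, ⟨?_, h'⟩, by linarith⟩
          by_contra hu
          nlinarith
      by_cases hu : u ∈ Set.Ioo (s / t) 1
      · rw [Set.indicator_of_mem hu, Set.indicator_of_mem (hiff.2 hu)]
      · rw [Set.indicator_of_notMem hu, Set.indicator_of_notMem (fun h => hu (hiff.1 h))]
    · rw [Set.indicator_of_notMem ht]
      rw [lintegral_eq_zero_iff' (by
        exact ((hfm.ennreal_ofReal.indicator hSm).comp measurable_prodMk_left).aemeasurable)]
      refine Filter.Eventually.of_forall fun u => ?_
      refine Set.indicator_of_notMem (fun h => ht ?_) _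
      obtain ⟨⟨p1, p2⟩, ⟨p3, p4⟩, p5⟩ := h
      simp only at p1 p2 p3 p4 p5
      exact ⟨by nlinarith, p2⟩
  set K : ℝ := s ^ (a₂ - a₁) * (1 - s) ^ (b₁ + b₂ + b₃ - a₁ - a₂ - a₃ - 1) with hK
  set P : ℝ → ℝ := fun y => y ^ (b₁ + b₃ - a₁ - a₃ - 1) * (1 - y) ^ (b₂ - a₂ - 1) *
            (1 - y * (1 - s)) ^ (-(b₂ - a₃)) with hP
  set Q : ℝ → ℝ → ℝ := fun y v => v ^ (b₁ - a₁ - 1) * (1 - v) ^ (b₃ - a₃ - 1) *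
    (1 - y * (1 - s) * v) ^ (-(b₃ - a₁)) with hQ
  have hK0 : 0 ≤ K := by positivity
  have hP0 : ∀ y ∈ Set.Ioo (0:ℝ) 1, 0 ≤ P y := fun y hy => by
    have := hy.1
    have : 0 < 1 - y := by linarith [hy.2]
    have : 0 < 1 - y * (1 - s) := by nlinarith
    positivity
  have hz : ∀ y ∈ Set.Ioo (0:ℝ) 1, 0 ≤ y * (1 - s) ∧ y * (1 - s) < 1 := fun y hy =>
    ⟨mul_nonneg hy.1.le hms.le, by nlinarith [hy.1, hy.2]⟩
  have hQ0 : ∀ y ∈ Set.Ioo (0:ℝ) 1, ∀ v ∈ Set.Ioo (0:ℝ) 1, 0 ≤ Q y v := fun y hy v hv => by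
    have := hv.1
    have : 0 < 1 - v := by linarith [hv.2]
    have := hz y hy
    have : 0 < 1 - y * (1 - s) * v := by nlinarith
    positivity
  have hE := fun y (hy : y ∈ Set.Ioo (0:ℝ) 1) => euler (b₁ - a₁) (b₃ - a₃) (b₃ - a₁) (y * (1 - s))
    (by linarith [h₁.2]) (by linarith [h₃.2]) (hz y hy).1 (hz y hy).2
  have hL2 : ∫⁻ t in Set.Ioo s 1, ∫⁻ u in Set.Ioo (s / t) 1, ENNReal.ofReal (f (t, u)) =
      ∫⁻ y in Set.Ioo (0:ℝ) 1, ENNReal.ofReal (K * P y * ∫ v in Set.Ioo (0:ℝ) 1, Q y v) := by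
    rw [mob_lint s hs0 hs1]
    refine setLIntegral_congr_fun measurableSet_Ioo fun y hy => ?_
    have hw : 0 < 1 - (1 - s) * y := by linarith [(hz y hy).2]
    have hr : s / (s / (1 - (1 - s) * y)) = 1 - (1 - s) * y := by field_simp
    have hr0 : 0 < s / (s / (1 - (1 - s) * y)) := by rw [hr]; exact hw
    have hr1 : s / (s / (1 - (1 - s) * y)) < 1 := by rw [hr]; nlinarith [mul_pos hms hy.1]
    have hJ : 0 ≤ s * (1 - s) / (1 - (1 - s) * y) ^ 2 := by positivity
    beta_reduce
    rw [mob_lint _ hr0 hr1, ENNReal.ofReal_mul (mul_nonneg hK0 (hP0 y hy)),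
      ofReal_integral_eq_lintegral_ofReal (hE y hy).1 (by
        filter_upwards [ae_restrict_mem measurableSet_Ioo] with v hv using hQ0 y hy v hv),
      ← lintegral_const_mul' _ _ ENNReal.ofReal_ne_top,
      ← lintegral_const_mul' _ _ ENNReal.ofReal_ne_top]
    refine setLIntegral_congr_fun measurableSet_Ioo fun v hv => ?_
    beta_reduce
    rw [← ENNReal.ofReal_mul (by
        have := sub_pos.2 hr1
        positivity), ← ENNReal.ofReal_mul hJ,
      ← ENNReal.ofReal_mul (mul_nonneg hK0 (hP0 y hy))]
    congr 1
    exact key2 a₁ a₂ a₃ b₁ b₂ b₃ s y v hs0 hs1 hy hv _ _ _ rfl rfl rfl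
  have hQm : StronglyMeasurable fun y => ∫ v in Set.Ioo (0:ℝ) 1, Q y v := by
    apply StronglyMeasurable.integral_prod_right
    apply Measurable.stronglyMeasurable
    simp only [hQ, Function.uncurry_def]
    fun_prop
  have hPm : Measurable P := by fun_prop
  rw [hg, hL, hL2, ← integral_eq_lintegral_of_nonneg_ae]
  · rw [← integral_const_mul]
    refine setIntegral_congr_fun measurableSet_Ioo fun y hy => ?_
    have := (hE y hy).2
    simp only [hQ]
    rw [this, show b₁ - a₁ + (b₃ - a₃) = b₁ + b₃ - a₁ - a₃ by ring]
    ring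
  · filter_upwards [ae_restrict_mem measurableSet_Ioo] with y hy
    exact mul_nonneg (mul_nonneg hK0 (hP0 y hy))
      (setIntegral_nonneg measurableSet_Ioo (hQ0 y hy))
  · exact ((hPm.const_mul K).mul hQm.measurable).aestronglyMeasurable
end

section
/- Let b_k > a_k > 0 for k = 1, 2, 3, let σ ∈ ℝ and x > −1. Then F(σ; a_1, a_2, a_3; b_1, b_2, b_3; −x) = [Γ(b_1)Γ(b_2)Γ(b_3)/(Γ(a_1)Γ(a_2)Γ(a_3)Γ(b_2−a_2)Γ(b_1+b_3−a_1−a_3))] × ∫_0^1 ∫_0^1 s^{a_2−1} y^{b_1+b_3−a_1−a_3−1} (1−s)^{b_1+b_2+b_3−a_1−a_2−a_3−1} (1−y)^{b_2−a_2−1} (1+sx)^{−σ} (1 − y(1−s))^{−(b_2−a_3)} ₂F₁(b_3−a_1, b_1−a_1; b_1+b_3−a_1−a_3; y(1−s)) ds dy. -/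
open MeasureTheory Real

/-- Generalized hypergeometric function `F(σ;(a_q);(b_q);−x)` (with `q = n+1` upper/lower
parameter pairs), defined via the multiple Euler integral. -/
noncomputable def hypF {n : ℕ} (σ : ℝ) (a b : Fin (n + 1) → ℝ) (x : ℝ) : ℝ :=
  (∏ k, Gamma (b k) / (Gamma (a k) * Gamma (b k - a k))) *
    ∫ t : Fin (n + 1) → ℝ in Set.univ.pi fun _ => Set.Icc (0 : ℝ) 1,
      (∏ k, t k ^ (a k - 1) * (1 - t k) ^ (b k - a k - 1)) * (1 + (∏ k, t k) * x) ^ (-σ)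

open Set in
lemma aux_beta_lint {α β : ℝ} (hα : 0 < α) (hβ : 0 < β) :
    ∫⁻ w in Ioo (0:ℝ) 1, ENNReal.ofReal (w ^ (α - 1) * (1 - w) ^ (β - 1)) =
      ENNReal.ofReal (ProbabilityTheory.beta α β) := by
  have h := ProbabilityTheory.lintegral_betaPDF_eq_one hα hβ
  have hb := ProbabilityTheory.beta_pos hα hβ
  rw [ProbabilityTheory.lintegral_betaPDF] at h
  have h2 : ∀ w : ℝ, ENNReal.ofReal (w ^ (α - 1) * (1 - w) ^ (β - 1)) =
      ENNReal.ofReal (ProbabilityTheory.beta α β) *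
        ENNReal.ofReal (1 / ProbabilityTheory.beta α β * w ^ (α - 1) * (1 - w) ^ (β - 1)) := by
    intro w
    rw [← ENNReal.ofReal_mul hb.le]
    congr 1
    field_simp
  simp_rw [h2]
  rw [lintegral_const_mul' _ _ ENNReal.ofReal_ne_top, h, mul_one]

lemma aux_nonneg {α β w : ℝ} (hw : w ∈ Set.Ioo (0:ℝ) 1) :
    0 ≤ w ^ (α - 1) * (1 - w) ^ (β - 1) :=
  mul_nonneg (rpow_nonneg hw.1.le _) (rpow_nonneg (by linarith [hw.2]) _)

lemma aux_beta_int {α β : ℝ} (hα : 0 < α) (hβ : 0 < β) :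
    IntegrableOn (fun w : ℝ => w ^ (α - 1) * (1 - w) ^ (β - 1)) (Set.Ioo 0 1) := by
  refine (lintegral_ofReal_ne_top_iff_integrable (by fun_prop) ?_).1 ?_
  · filter_upwards [ae_restrict_mem measurableSet_Ioo] with w hw using aux_nonneg hw
  · rw [aux_beta_lint hα hβ]; exact ENNReal.ofReal_ne_top

lemma aux_beta_val {α β : ℝ} (hα : 0 < α) (hβ : 0 < β) :
    ∫ w in Set.Ioo (0:ℝ) 1, w ^ (α - 1) * (1 - w) ^ (β - 1) = ProbabilityTheory.beta α β := by
  rw [integral_eq_lintegral_of_nonneg_ae, aux_beta_lint hα hβ,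
    ENNReal.toReal_ofReal (ProbabilityTheory.beta_pos hα hβ).le]
  · filter_upwards [ae_restrict_mem measurableSet_Ioo] with w hw using aux_nonneg hw
  · fun_prop

lemma aux_binom (α z : ℝ) (h0 : 0 ≤ z) (h1 : z < 1) :
    HasSum (fun n : ℕ => poch α n / (n.factorial : ℝ) * z ^ n) ((1 - z) ^ (-α)) := by
  have h := (Real.one_div_one_sub_rpow_hasFPowerSeriesOnBall_zero α).hasSum (y := z)
    (by simp [enorm_eq_nnnorm, ← NNReal.coe_lt_coe, abs_of_nonneg h0, h1])
  rw [zero_add, one_div, ← rpow_neg (by linarith)] at h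
  convert! h using 2 with n
  simp only [FormalMultilinearSeries.ofScalars_apply_eq, smul_eq_mul]
  congr 1
  rw [← Ring.multichoose_eq, poch, div_eq_iff (by positivity), mul_comm, ← nsmul_eq_mul,
    Ring.factorial_nsmul_multichoose_eq_ascPochhammer, Polynomial.ascPochhammer_smeval_eq_eval]

lemma poch_succ (a : ℝ) (n : ℕ) : poch a (n + 1) = poch a n * (a + n) := by
  simp [poch, ascPochhammer_succ_right, Polynomial.eval_mul]

lemma poch_pos_s18 {a : ℝ} (ha : 0 < a) (n : ℕ) : 0 < poch a n := by
  simpa [poch] using ascPochhammer_pos n a ha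

lemma aux_beta_shift {α β : ℝ} (hα : 0 < α) (hβ : 0 < β) (n : ℕ) :
    ProbabilityTheory.beta (α + n) β =
      ProbabilityTheory.beta α β * (poch α n / poch (α + β) n) := by
  induction n with
  | zero => simp [poch]
  | succ n ih =>
    have e : ProbabilityTheory.beta (α + (n + 1 : ℕ)) β =
        ProbabilityTheory.beta (α + n) β * ((α + n) / (α + β + n)) := by
      unfold ProbabilityTheory.beta
      have h1 : α + ((n + 1 : ℕ) : ℝ) = (α + n) + 1 := by push_cast; ring
      have h2 : α + n + 1 + β = (α + n + β) + 1 := by ring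
      have p1 : 0 < α + n := by positivity
      have p2 : 0 < α + n + β := by positivity
      have p3 := Gamma_pos_of_pos p2
      rw [h1, h2, Gamma_add_one p1.ne', Gamma_add_one p2.ne',
        show α + β + n = α + n + β by ring]
      field_simp
    have := poch_pos_s18 (add_pos hα hβ) n
    rw [e, ih, poch_succ, poch_succ]
    field_simp

lemma aux_euler (α β γ z : ℝ) (hβ : 0 < β) (hγ : 0 < γ) (h0 : 0 ≤ z) (h1 : z < 1) :
    ∫ w in Set.Ioo (0:ℝ) 1, w ^ (β - 1) * (1 - w) ^ (γ - 1) * (1 - w * z) ^ (-α) =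
      ProbabilityTheory.beta β γ * F21 α β (β + γ) z := by
  have e : ∀ n : ℕ, ∀ w ∈ Set.Ioo (0:ℝ) 1,
      w ^ (β - 1) * (1 - w) ^ (γ - 1) * (poch α n / (n.factorial : ℝ) * (w * z) ^ n) =
      (poch α n / (n.factorial : ℝ) * z ^ n) * (w ^ (β + n - 1) * (1 - w) ^ (γ - 1)) := by
    intro n w hw
    rw [show β + n - 1 = (β - 1) + n by ring, rpow_add hw.1, rpow_natCast, mul_pow]
    ring
  have hn : ∀ n : ℕ, 0 < β + n := fun n => by positivity
  have hI : ∀ n : ℕ, IntegrableOn (fun w : ℝ => (poch α n / (n.factorial : ℝ) * z ^ n) *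
      (w ^ (β + n - 1) * (1 - w) ^ (γ - 1))) (Set.Ioo 0 1) :=
    fun n => (aux_beta_int (hn n) hγ).const_mul _
  have hv : ∀ n : ℕ, ∫ w in Set.Ioo (0:ℝ) 1, (poch α n / (n.factorial : ℝ) * z ^ n) *
      (w ^ (β + n - 1) * (1 - w) ^ (γ - 1)) =
      ProbabilityTheory.beta β γ *
        (poch α n * poch β n / (poch (β + γ) n * (n.factorial : ℝ)) * z ^ n) := by
    intro n
    rw [integral_const_mul, aux_beta_val (hn n) hγ, aux_beta_shift hβ hγ]
    have := poch_pos_s18 (add_pos hβ hγ) n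
    field_simp
  have key := hasSum_integral_of_summable_integral_norm (μ := volume.restrict (Set.Ioo (0:ℝ) 1))
    (F := fun (n : ℕ) (w : ℝ) => (poch α n / (n.factorial : ℝ) * z ^ n) *
      (w ^ (β + n - 1) * (1 - w) ^ (γ - 1))) hI ?_
  · simp_rw [hv] at key
    rw [F21, ← tsum_mul_left, key.tsum_eq]
    refine setIntegral_congr_fun measurableSet_Ioo fun w hw => ?_
    rw [tsum_congr (fun n => (e n w hw).symm), tsum_mul_left,
      (aux_binom α (w * z) (by have := hw.1; positivity) (by nlinarith [hw.1, hw.2])).tsum_eq]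
  · have hs : Summable fun n : ℕ => |poch α n / (n.factorial : ℝ) * z ^ n| *
        ProbabilityTheory.beta β γ := (aux_binom α z h0 h1).summable.abs.mul_right _
    refine Summable.of_nonneg_of_le (fun n => integral_nonneg fun w => norm_nonneg _) ?_ hs
    intro n
    have : ∀ w ∈ Set.Ioo (0:ℝ) 1, ‖(poch α n / (n.factorial : ℝ) * z ^ n) *
      (w ^ (β + n - 1) * (1 - w) ^ (γ - 1))‖ ≤ |poch α n / (n.factorial : ℝ) * z ^ n| *
       (w ^ (β - 1) * (1 - w) ^ (γ - 1)) := by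
      intro w hw
      rw [norm_mul, Real.norm_eq_abs, Real.norm_of_nonneg (aux_nonneg hw)]
      have : w ^ (β + n - 1) ≤ w ^ (β - 1) :=
        rpow_le_rpow_of_exponent_ge hw.1 hw.2.le (by have : (0:ℝ) ≤ n := by positivity
                                                     linarith)
      have h3 : 0 ≤ (1 - w) ^ (γ - 1) := rpow_nonneg (by linarith [hw.2]) _
      gcongr
    rw [← aux_beta_val hβ hγ, ← integral_const_mul]
    exact setIntegral_mono_on (hI n).norm ((aux_beta_int hβ hγ).const_mul _) measurableSet_Ioo this

lemma aux_euler_int (α β γ z : ℝ) (hβ : 0 < β) (hγ : 0 < γ) (h0 : 0 ≤ z) (h1 : z < 1) :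
    IntegrableOn (fun w : ℝ => w ^ (β - 1) * (1 - w) ^ (γ - 1) * (1 - w * z) ^ (-α))
      (Set.Ioo 0 1) := by
  refine (aux_beta_int hβ hγ).mul_bdd (c := max 1 ((1 - z) ^ (-α)))
    (Measurable.aestronglyMeasurable (by fun_prop)) ?_
  filter_upwards [ae_restrict_mem measurableSet_Ioo] with w hw
  have hp : 0 < 1 - w * z := by nlinarith [hw.1, hw.2]
  have hp2 : 1 - z ≤ 1 - w * z := by nlinarith [hw.1, hw.2]
  have hp3 : 1 - w * z ≤ 1 := by nlinarith [hw.1, hw.2]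
  rw [Real.norm_of_nonneg (rpow_nonneg hp.le _)]
  rcases le_total 0 α with h | h
  · exact le_max_of_le_right (rpow_le_rpow_of_nonpos (by linarith) hp2 (by linarith))
  · exact le_max_of_le_left (rpow_le_one hp.le hp3 (by linarith))

lemma aux_euler_lint (α β γ z : ℝ) (hβ : 0 < β) (hγ : 0 < γ) (h0 : 0 ≤ z) (h1 : z < 1) :
    ∫⁻ w in Set.Ioo (0:ℝ) 1,
        ENNReal.ofReal (w ^ (β - 1) * (1 - w) ^ (γ - 1) * (1 - w * z) ^ (-α)) =
      ENNReal.ofReal (ProbabilityTheory.beta β γ * F21 α β (β + γ) z) := by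
  rw [← aux_euler α β γ z hβ hγ h0 h1, ofReal_integral_eq_lintegral_ofReal]
  · exact aux_euler_int α β γ z hβ hγ h0 h1
  · filter_upwards [ae_restrict_mem measurableSet_Ioo] with w hw
    exact mul_nonneg (aux_nonneg hw) (rpow_nonneg (by nlinarith [hw.1, hw.2]) _)

lemma F21_nonneg (α β γ z : ℝ) (hβ : 0 < β) (hγ : 0 < γ) (h0 : 0 ≤ z) (h1 : z < 1) :
    0 ≤ F21 α β (β + γ) z := by
  have h := aux_euler α β γ z hβ hγ h0 h1
  have h2 : 0 ≤ ProbabilityTheory.beta β γ * F21 α β (β + γ) z := by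
    rw [← h]
    refine setIntegral_nonneg measurableSet_Ioo fun w hw => ?_
    exact mul_nonneg (aux_nonneg hw) (rpow_nonneg (by nlinarith [hw.1, hw.2]) _)
  exact nonneg_of_mul_nonneg_right h2 (ProbabilityTheory.beta_pos hβ hγ)

lemma aux_sub1 (t : ℝ) (ht : t ∈ Set.Ioo (0:ℝ) 1) (K : ℝ → ENNReal) :
    ∫⁻ r in Set.Ioo (0:ℝ) 1, K r =
      ∫⁻ u in Set.Ioo (0:ℝ) 1, (Set.Iio t).indicator (fun u => ENNReal.ofReal (1 / t) * K (u / t)) u := by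
  have him : (fun u : ℝ => u / t) '' Set.Ioo 0 t = Set.Ioo 0 1 := by
    ext r
    simp only [Set.mem_image, Set.mem_Ioo]
    constructor
    · rintro ⟨u, ⟨h1, h2⟩, rfl⟩
      exact ⟨div_pos h1 ht.1, (div_lt_one ht.1).2 h2⟩
    · rintro ⟨h1, h2⟩
      exact ⟨r * t, ⟨mul_pos h1 ht.1, by nlinarith [ht.1]⟩, by have := ht.1.ne'; field_simp⟩
  conv_lhs => rw [← him]
  rw [lintegral_image_eq_lintegral_abs_deriv_mul measurableSet_Ioo
    (f := fun u => u / t) (f' := fun _ => 1 / t) (fun x _ => ((hasDerivAt_id x).div_const t).hasDerivWithinAt)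
    (fun x _ y _ h => by have := ht.1.ne'; field_simp at h; exact h),
    setLIntegral_indicator measurableSet_Iio]
  have : Set.Iio t ∩ Set.Ioo 0 1 = Set.Ioo 0 t := by
    ext u; simp only [Set.mem_inter_iff, Set.mem_Iio, Set.mem_Ioo]
    have := ht.2
    constructor
    · rintro ⟨h1, h2, h3⟩; exact ⟨h2, h1⟩
    · rintro ⟨h1, h2⟩; exact ⟨h2, h1, by linarith⟩
  rw [this, abs_of_pos (by have := ht.1; positivity)]

lemma aux_sub2 (u : ℝ) (hu : u ∈ Set.Ioo (0:ℝ) 1) (K : ℝ → ENNReal) :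
    ∫⁻ t in Set.Ioo (0:ℝ) 1, (Set.Ioi u).indicator K t =
      ∫⁻ w in Set.Ioo (0:ℝ) 1, ENNReal.ofReal (1 - u) * K (1 - w * (1 - u)) := by
  have hp : 0 < 1 - u := by linarith [hu.2]
  have him : (fun w : ℝ => 1 - w * (1 - u)) '' Set.Ioo 0 1 = Set.Ioo u 1 := by
    ext r
    simp only [Set.mem_image, Set.mem_Ioo]
    constructor
    · rintro ⟨w, ⟨h1, h2⟩, rfl⟩
      constructor <;> nlinarith
    · rintro ⟨h1, h2⟩
      refine ⟨(1 - r) / (1 - u), ⟨div_pos (by linarith) hp, (div_lt_one hp).2 (by linarith)⟩, ?_⟩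
      field_simp; ring
  rw [setLIntegral_indicator measurableSet_Ioi]
  have : Set.Ioi u ∩ Set.Ioo 0 1 = Set.Ioo u 1 := by
    ext t; simp only [Set.mem_inter_iff, Set.mem_Ioi, Set.mem_Ioo]
    have := hu.1
    constructor
    · rintro ⟨h1, h2, h3⟩; exact ⟨h1, h3⟩
    · rintro ⟨h1, h2⟩; exact ⟨h1, by linarith, h2⟩
  rw [this, ← him, lintegral_image_eq_lintegral_abs_deriv_mul measurableSet_Ioo
    (f := fun w => 1 - w * (1 - u)) (f' := fun _ => -(1 * (1 - u)))
    (fun x _ => (((hasDerivAt_id x).mul_const (1 - u)).const_sub 1).hasDerivWithinAt)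
    (fun x _ y _ h => by
      have h' : x * (1 - u) = y * (1 - u) := by simpa using h
      exact mul_right_cancel₀ hp.ne' h')]
  rw [one_mul, abs_neg, abs_of_pos hp]

lemma aux_D (K : ℝ → ℝ → ENNReal) (hK : Measurable (Function.uncurry K)) :
    ∫⁻ t in Set.Ioo (0:ℝ) 1, ∫⁻ r in Set.Ioo (0:ℝ) 1, K t r =
      ∫⁻ u in Set.Ioo (0:ℝ) 1, ∫⁻ w in Set.Ioo (0:ℝ) 1,
        ENNReal.ofReal (1 - u) * (ENNReal.ofReal (1 / (1 - w * (1 - u))) *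
          K (1 - w * (1 - u)) (u / (1 - w * (1 - u)))) := by
  rw [setLIntegral_congr_fun measurableSet_Ioo (fun t ht => aux_sub1 t ht (K t))]
  rw [lintegral_lintegral_swap]
  · refine setLIntegral_congr_fun measurableSet_Ioo (fun u hu => ?_)
    rw [← aux_sub2 u hu (fun t => ENNReal.ofReal (1 / t) * K t (u / t))]
    rfl
  · refine Measurable.aemeasurable ?_
    have : Function.uncurry (fun t u : ℝ => (Set.Iio t).indicator
        (fun u => ENNReal.ofReal (1 / t) * K t (u / t)) u) =
        {p : ℝ × ℝ | p.2 < p.1}.indicator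
          (fun p => ENNReal.ofReal (1 / p.1) * Function.uncurry K (p.1, p.2 / p.1)) := by
      ext ⟨t, u⟩; simp [Set.indicator, Function.uncurry]
    rw [this]
    refine Measurable.indicator ?_ (measurableSet_lt measurable_snd measurable_fst)
    exact Measurable.mul (by fun_prop) (hK.comp (by fun_prop))

lemma aux_P (A C A' C' u w : ℝ) (hu : u ∈ Set.Ioo (0:ℝ) 1) (hw : w ∈ Set.Ioo (0:ℝ) 1) :
    (1 - u) * (1 / (1 - w * (1 - u)) * (((1 - w * (1 - u)) ^ (A - 1) *
      (1 - (1 - w * (1 - u))) ^ (C - 1)) * ((u / (1 - w * (1 - u))) ^ (A' - 1) *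
      (1 - u / (1 - w * (1 - u))) ^ (C' - 1)))) =
    u ^ (A' - 1) * (1 - u) ^ (C + C' - 1) * (w ^ (C - 1) * (1 - w) ^ (C' - 1) *
      (1 - w * (1 - u)) ^ (A - A' - C')) := by
  obtain ⟨hu0, hu1⟩ := hu
  obtain ⟨hw0, hw1⟩ := hw
  have pu : 0 < 1 - u := by linarith
  have pw : 0 < 1 - w := by linarith
  have pT : 0 < 1 - w * (1 - u) := by nlinarith
  have e1 : 1 - (1 - w * (1 - u)) = w * (1 - u) := by ring
  have e2 : 1 - u / (1 - w * (1 - u)) = (1 - w) * (1 - u) / (1 - w * (1 - u)) := by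
    field_simp; ring
  rw [e1, e2]
  generalize 1 - w * (1 - u) = T at *
  have hT : T ^ (A - A' - C') = T ^ (A - 1) / T / T ^ (A' - 1) / T ^ (C' - 1) := by
    rw [← rpow_sub_one pT.ne', ← rpow_sub pT, ← rpow_sub pT]
    congr 1; ring
  rw [mul_rpow hw0.le pu.le, div_rpow hu0.le pT.le, div_rpow (by positivity) pT.le,
    mul_rpow pw.le pu.le, show C + C' - 1 = 1 + (C - 1) + (C' - 1) by ring,
    rpow_add pu, rpow_add pu, rpow_one, hT]
  field_simp

lemma aux_pi (Φ : ℝ → ℝ → ℝ → ENNReal)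
    (hΦ : Measurable fun p : ℝ × ℝ × ℝ => Φ p.1 p.2.1 p.2.2) :
    ∫⁻ t : Fin 3 → ℝ in Set.univ.pi fun _ => Set.Icc (0 : ℝ) 1, Φ (t 0) (t 1) (t 2) =
      ∫⁻ t₂ in Set.Ioo (0:ℝ) 1, ∫⁻ t₁ in Set.Ioo (0:ℝ) 1, ∫⁻ t₃ in Set.Ioo (0:ℝ) 1,
        Φ t₁ t₂ t₃ := by
  have h0 : (volume : Measure (Fin 3 → ℝ)).restrict (Set.univ.pi fun _ => Set.Icc (0 : ℝ) 1) =
      Measure.pi (fun _ : Fin 3 => (volume : Measure ℝ).restrict (Set.Ioo 0 1)) := by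
    rw [volume_pi, Measure.restrict_pi_pi]
    congr 1
    funext i
    exact (Measure.restrict_congr_set Ioo_ae_eq_Icc).symm
  rw [h0]
  set μ : Measure ℝ := (volume : Measure ℝ).restrict (Set.Ioo 0 1)
  have h1 := (measurePreserving_piFinSuccAbove (fun _ : Fin 3 => μ) 1)
  have h2 := (measurePreserving_finTwoArrow μ)
  have h3 : ∫⁻ t : Fin 3 → ℝ, Φ (t 0) (t 1) (t 2) ∂(Measure.pi fun _ : Fin 3 => μ) =
      ∫⁻ p : ℝ × (Fin 2 → ℝ), Φ (p.2 0) p.1 (p.2 1) ∂(μ.prod (Measure.pi fun _ : Fin 2 => μ)) := by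
    rw [← h1.lintegral_comp_emb (MeasurableEquiv.measurableEmbedding _)]
    rfl
  rw [h3, lintegral_prod _ (Measurable.aemeasurable (by
    exact hΦ.comp (f := fun p : ℝ × (Fin 2 → ℝ) => (p.2 0, p.1, p.2 1)) (by fun_prop)))]
  refine lintegral_congr fun t₂ => ?_
  have h4 : ∫⁻ t : Fin 2 → ℝ, Φ (t 0) t₂ (t 1) ∂(Measure.pi fun _ : Fin 2 => μ) =
      ∫⁻ p : ℝ × ℝ, Φ p.1 t₂ p.2 ∂(μ.prod μ) := by
    rw [← h2.lintegral_comp_emb (MeasurableEquiv.measurableEmbedding _)]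
    rfl
  rw [h4, lintegral_prod _ (Measurable.aemeasurable (by
    exact hΦ.comp (f := fun p : ℝ × ℝ => (p.1, t₂, p.2)) (by fun_prop)))]

lemma aux_bdd (σ x : ℝ) (hx : -1 < x) :
    ∃ M, ∀ p ∈ Set.Icc (0:ℝ) 1, (1 + p * x) ^ (-σ) ≤ M := by
  have hc : ContinuousOn (fun p : ℝ => (1 + p * x) ^ (-σ)) (Set.Icc 0 1) := by
    refine ContinuousOn.rpow_const (by fun_prop) fun p hp => Or.inl ?_
    have : 0 < 1 + p * x := by
      rcases hp.1.eq_or_lt with h | h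
      · rw [← h]; norm_num
      · nlinarith [hp.2, mul_pos h (show 0 < 1 + x by linarith)]
    exact this.ne'
  obtain ⟨M, hM⟩ := isCompact_Icc.exists_bound_of_continuousOn hc
  exact ⟨M, fun p hp => (le_abs_self _).trans (hM p hp)⟩

/-- weight -/
noncomputable def wt (a c t : ℝ) : ℝ := t ^ (a - 1) * (1 - t) ^ (c - 1)

lemma wt_meas (a c : ℝ) : Measurable (wt a c) := by unfold wt; fun_prop

lemma wt_nonneg (a c t : ℝ) (ht : t ∈ Set.Icc (0:ℝ) 1) : 0 ≤ wt a c t :=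
  mul_nonneg (rpow_nonneg ht.1 _) (rpow_nonneg (by linarith [ht.2]) _)

lemma wt_nonneg' (a c t : ℝ) (ht : t ∈ Set.Ioo (0:ℝ) 1) : 0 ≤ wt a c t :=
  wt_nonneg a c t (Set.Ioo_subset_Icc_self ht)

/-- Triple lower integral. -/
noncomputable def LL (σ x a₁ a₂ a₃ c₁ c₂ c₃ : ℝ) : ENNReal :=
  ∫⁻ t₂ in Set.Ioo (0:ℝ) 1, ∫⁻ t₁ in Set.Ioo (0:ℝ) 1, ∫⁻ t₃ in Set.Ioo (0:ℝ) 1,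
    ENNReal.ofReal (wt a₁ c₁ t₁ * wt a₂ c₂ t₂ * wt a₃ c₃ t₃ * (1 + t₁ * t₂ * t₃ * x) ^ (-σ))

lemma LL_lt_top (σ x a₁ a₂ a₃ c₁ c₂ c₃ : ℝ) (hx : -1 < x) (ha₁ : 0 < a₁) (ha₂ : 0 < a₂)
    (ha₃ : 0 < a₃) (hc₁ : 0 < c₁) (hc₂ : 0 < c₂) (hc₃ : 0 < c₃) :
    LL σ x a₁ a₂ a₃ c₁ c₂ c₃ < ⊤ := by
  obtain ⟨M, hM⟩ := aux_bdd σ x hx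
  have hb : ∀ a c : ℝ, 0 < a → 0 < c →
      ∫⁻ t in Set.Ioo (0:ℝ) 1, ENNReal.ofReal (wt a c t) < ⊤ := fun a c ha hc => by
    unfold wt
    rw [aux_beta_lint ha hc]; exact ENNReal.ofReal_lt_top
  have hle : LL σ x a₁ a₂ a₃ c₁ c₂ c₃ ≤
      ∫⁻ t₂ in Set.Ioo (0:ℝ) 1, ENNReal.ofReal (wt a₂ c₂ t₂) * ∫⁻ t₁ in Set.Ioo (0:ℝ) 1,
        ENNReal.ofReal (wt a₁ c₁ t₁) * ∫⁻ t₃ in Set.Ioo (0:ℝ) 1,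
          ENNReal.ofReal (wt a₃ c₃ t₃) * ENNReal.ofReal M := by
    unfold LL
    refine setLIntegral_mono' measurableSet_Ioo fun t₂ h2 => ?_
    rw [← lintegral_const_mul' _ _ ENNReal.ofReal_ne_top]
    refine setLIntegral_mono' measurableSet_Ioo fun t₁ h1 => ?_
    rw [← lintegral_const_mul' _ _ ENNReal.ofReal_ne_top,
      ← lintegral_const_mul' _ _ ENNReal.ofReal_ne_top]
    refine setLIntegral_mono' measurableSet_Ioo fun t₃ h3 => ?_
    have n1 := wt_nonneg' a₁ c₁ t₁ h1
    have n2 := wt_nonneg' a₂ c₂ t₂ h2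
    have n3 := wt_nonneg' a₃ c₃ t₃ h3
    rw [← ENNReal.ofReal_mul n3, ← ENNReal.ofReal_mul n1, ← ENNReal.ofReal_mul n2]
    refine ENNReal.ofReal_le_ofReal ?_
    have := hM (t₁ * t₂ * t₃) ⟨by have := h1.1; have := h2.1; have := h3.1; positivity, by
      have : t₁ * t₂ ≤ 1 := by nlinarith [h1.1, h1.2, h2.1, h2.2]
      have : 0 ≤ t₁ * t₂ := by have := h1.1; have := h2.1; positivity
      nlinarith [h3.1, h3.2]⟩
    calc _ ≤ wt a₁ c₁ t₁ * wt a₂ c₂ t₂ * wt a₃ c₃ t₃ * M := by gcongr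
      _ = _ := by ring
  refine hle.trans_lt ?_
  rw [lintegral_mul_const' _ _ ENNReal.ofReal_ne_top]
  have f3 := ENNReal.mul_lt_top (hb a₃ c₃ ha₃ hc₃) (ENNReal.ofReal_lt_top (r := M))
  have m1 : ∀ a c : ℝ, Measurable fun t => ENNReal.ofReal (wt a c t) := fun a c =>
    (wt_meas a c).ennreal_ofReal
  rw [lintegral_mul_const _ (m1 a₁ c₁)]
  have f1 := ENNReal.mul_lt_top (hb a₁ c₁ ha₁ hc₁) f3
  rw [lintegral_mul_const _ (m1 a₂ c₂)]
  exact ENNReal.mul_lt_top (hb a₂ c₂ ha₂ hc₂) f1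

/-- Euler integral as a lower integral -/
noncomputable def QQ (α β γ z : ℝ) : ENNReal :=
  ∫⁻ w in Set.Ioo (0:ℝ) 1,
        ENNReal.ofReal (wt β γ w * (1 - w * z) ^ (-α))

lemma QQ_meas (α β γ : ℝ) : Measurable (QQ α β γ) := by
  unfold QQ
  refine Measurable.lintegral_prod_right' (f := fun p : ℝ × ℝ =>
    ENNReal.ofReal (wt β γ p.2 * (1 - p.2 * p.1) ^ (-α))) ?_
  have := wt_meas β γ
  fun_prop

lemma LL_eq (σ x a₁ a₂ a₃ c₁ c₂ c₃ : ℝ) (hx : -1 < x) :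
    LL σ x a₁ a₂ a₃ c₁ c₂ c₃ =
      ∫⁻ y in Set.Ioo (0:ℝ) 1, ∫⁻ s in Set.Ioo (0:ℝ) 1,
        ENNReal.ofReal (s ^ (a₂ - 1) * (1 - s) ^ (c₁ + c₃ + c₂ - 1) *
          (y ^ (c₁ + c₃ - 1) * (1 - y) ^ (c₂ - 1) * (1 - y * (1 - s)) ^ (a₃ - a₂ - c₂)) *
          (1 + s * x) ^ (-σ)) * QQ (a₃ + c₃ - a₁) c₁ c₃ (y * (1 - s)) := by
  have m1 := wt_meas a₁ c₁
  have m2 := wt_meas a₂ c₂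
  have m3 := wt_meas a₃ c₃
  have m4 := wt_meas a₃ (c₁ + c₃)
  have mQ := QQ_meas (a₃ + c₃ - a₁) c₁ c₃
  have step1 : LL σ x a₁ a₂ a₃ c₁ c₂ c₃ = ∫⁻ t₂ in Set.Ioo (0:ℝ) 1, ∫⁻ u in Set.Ioo (0:ℝ) 1,
      ENNReal.ofReal (wt a₃ (c₁ + c₃) u * wt a₂ c₂ t₂ * (1 + u * t₂ * x) ^ (-σ)) *
        QQ (a₃ + c₃ - a₁) c₁ c₃ (1 - u) := by
    unfold LL
    refine setLIntegral_congr_fun measurableSet_Ioo fun t₂ h2 => ?_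
    rw [aux_D _ (by fun_prop)]
    refine setLIntegral_congr_fun measurableSet_Ioo fun u hu => ?_
    unfold QQ
    rw [← lintegral_const_mul' _ _ ENNReal.ofReal_ne_top]
    refine setLIntegral_congr_fun measurableSet_Ioo fun w hw => ?_
    have pT : 0 < 1 - w * (1 - u) := by nlinarith [hu.1, hu.2, hw.1, hw.2]
    have n2 := wt_nonneg' a₂ c₂ t₂ h2
    have n4 := wt_nonneg' a₃ (c₁ + c₃) u hu
    have ng : 0 ≤ (1 + u * t₂ * x) ^ (-σ) := by
      refine rpow_nonneg ?_ _
      have : u * t₂ ≤ 1 := by nlinarith [hu.1, hu.2, h2.1, h2.2]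
      have : 0 ≤ u * t₂ := mul_nonneg hu.1.le h2.1.le
      nlinarith
    rw [← ENNReal.ofReal_mul (by positivity), ← ENNReal.ofReal_mul (by linarith [hu.2]),
      ← ENNReal.ofReal_mul (by positivity)]
    congr 1
    have hP := aux_P a₁ c₁ a₃ c₃ u w hu hw
    have e1 : (1 - w * (1 - u)) * t₂ * (u / (1 - w * (1 - u))) = u * t₂ := by field_simp
    rw [e1, show -(a₃ + c₃ - a₁) = a₁ - a₃ - c₃ by ring]
    unfold wt at *
    linear_combination (t₂ ^ (a₂ - 1) * (1 - t₂) ^ (c₂ - 1) * (1 + u * t₂ * x) ^ (-σ)) * hP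
  rw [step1, lintegral_lintegral_swap (Measurable.aemeasurable (by
    unfold Function.uncurry; fun_prop)), aux_D _ (by unfold Function.uncurry; fun_prop),
    lintegral_lintegral_swap (Measurable.aemeasurable (by
    unfold Function.uncurry; fun_prop))]
  refine setLIntegral_congr_fun measurableSet_Ioo fun y hy => ?_
  refine setLIntegral_congr_fun measurableSet_Ioo fun s hs => ?_
  have pT : 0 < 1 - y * (1 - s) := by nlinarith [hs.1, hs.2, hy.1, hy.2]
  rw [← mul_assoc, ← mul_assoc, ← ENNReal.ofReal_mul (by linarith [hs.2]),
    ← ENNReal.ofReal_mul (mul_nonneg (by linarith [hs.2]) (by positivity)), sub_sub_cancel]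
  congr 2
  have hP := aux_P a₃ (c₁ + c₃) a₂ c₂ s y hs hy
  have e1 : (1 - y * (1 - s)) * (s / (1 - y * (1 - s))) = s := by field_simp
  rw [e1]
  unfold wt at *
  rw [sub_sub_cancel] at *
  linear_combination ((1 + s * x) ^ (-σ)) * hP

lemma hypF_eq (σ x a₁ a₂ a₃ b₁ b₂ b₃ : ℝ) (hx : -1 < x) :
    hypF σ ![a₁, a₂, a₃] ![b₁, b₂, b₃] x =
      (Gamma b₁ / (Gamma a₁ * Gamma (b₁ - a₁)) * (Gamma b₂ / (Gamma a₂ * Gamma (b₂ - a₂))) *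
        (Gamma b₃ / (Gamma a₃ * Gamma (b₃ - a₃)))) *
      (LL σ x a₁ a₂ a₃ (b₁ - a₁) (b₂ - a₂) (b₃ - a₃)).toReal := by
  have m1 := wt_meas a₁ (b₁ - a₁)
  have m2 := wt_meas a₂ (b₂ - a₂)
  have m3 := wt_meas a₃ (b₃ - a₃)
  unfold hypF LL
  rw [← aux_pi _ (by fun_prop), ← integral_eq_lintegral_of_nonneg_ae]
  · rw [Fin.prod_univ_three]
    congr 1
    refine integral_congr_ae (Filter.Eventually.of_forall fun t => ?_)
    beta_reduce
    rw [Fin.prod_univ_three, Fin.prod_univ_three]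
    rfl
  · have hm : MeasurableSet (Set.univ.pi fun _ : Fin 3 => Set.Icc (0 : ℝ) 1) :=
      MeasurableSet.univ_pi fun _ => measurableSet_Icc
    filter_upwards [ae_restrict_mem hm] with t ht
    have h : ∀ i, t i ∈ Set.Icc (0:ℝ) 1 := fun i => ht i (Set.mem_univ i)
    have n1 := wt_nonneg a₁ (b₁ - a₁) _ (h 0)
    have n2 := wt_nonneg a₂ (b₂ - a₂) _ (h 1)
    have n3 := wt_nonneg a₃ (b₃ - a₃) _ (h 2)
    have ng : 0 ≤ (1 + t 0 * t 1 * t 2 * x) ^ (-σ) := by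
      refine rpow_nonneg ?_ _
      have q1 : t 0 * t 1 ≤ 1 := mul_le_one₀ (h 0).2 (h 1).1 (h 1).2
      have q0 : 0 ≤ t 0 * t 1 := mul_nonneg (h 0).1 (h 1).1
      have q2 : t 0 * t 1 * t 2 ≤ 1 := mul_le_one₀ q1 (h 2).1 (h 2).2
      have q3 : 0 ≤ t 0 * t 1 * t 2 := mul_nonneg q0 (h 2).1
      nlinarith
    exact mul_nonneg (mul_nonneg (mul_nonneg n1 n2) n3) ng
  · refine Measurable.aestronglyMeasurable ?_
    fun_prop

/-- Representation of `₄F₃(σ, a₁, a₂, a₃; b₁, b₂, b₃; −x)` as a double integral of `₂F₁`. -/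
theorem hypF4F3_double_integral (σ x a₁ a₂ a₃ b₁ b₂ b₃ : ℝ)
    (h₁ : 0 < a₁ ∧ a₁ < b₁) (h₂ : 0 < a₂ ∧ a₂ < b₂) (h₃ : 0 < a₃ ∧ a₃ < b₃)
    (hx : -1 < x) :
    hypF σ ![a₁, a₂, a₃] ![b₁, b₂, b₃] x =
      Gamma b₁ * Gamma b₂ * Gamma b₃ /
          (Gamma a₁ * Gamma a₂ * Gamma a₃ * Gamma (b₂ - a₂) * Gamma (b₁ + b₃ - a₁ - a₃)) *
        ∫ y in Set.Ioo (0 : ℝ) 1, ∫ s in Set.Ioo (0 : ℝ) 1,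
          s ^ (a₂ - 1) * y ^ (b₁ + b₃ - a₁ - a₃ - 1) *
            (1 - s) ^ (b₁ + b₂ + b₃ - a₁ - a₂ - a₃ - 1) * (1 - y) ^ (b₂ - a₂ - 1) *
            (1 + s * x) ^ (-σ) * (1 - y * (1 - s)) ^ (-(b₂ - a₃)) *
            F21 (b₃ - a₁) (b₁ - a₁) (b₁ + b₃ - a₁ - a₃) (y * (1 - s)) := by
  have hc₁ : 0 < b₁ - a₁ := by linarith
  have hc₂ : 0 < b₂ - a₂ := by linarith
  have hc₃ : 0 < b₃ - a₃ := by linarith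
  have hfin := LL_lt_top σ x a₁ a₂ a₃ _ _ _ hx h₁.1 h₂.1 h₃.1 hc₁ hc₂ hc₃
  have hLL := LL_eq σ x a₁ a₂ a₃ (b₁ - a₁) (b₂ - a₂) (b₃ - a₃) hx
  have hB := ProbabilityTheory.beta_pos hc₁ hc₃
  have mQ := QQ_meas (a₃ + (b₃ - a₃) - a₁) (b₁ - a₁) (b₃ - a₃)
  set q : ℝ → ℝ → ENNReal := fun y s =>
    ENNReal.ofReal (s ^ (a₂ - 1) * (1 - s) ^ (b₁ - a₁ + (b₃ - a₃) + (b₂ - a₂) - 1) *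
          (y ^ (b₁ - a₁ + (b₃ - a₃) - 1) * (1 - y) ^ (b₂ - a₂ - 1) *
            (1 - y * (1 - s)) ^ (a₃ - a₂ - (b₂ - a₂))) *
          (1 + s * x) ^ (-σ)) * QQ (a₃ + (b₃ - a₃) - a₁) (b₁ - a₁) (b₃ - a₃) (y * (1 - s)) with hq
  have hqm : Measurable (Function.uncurry q) := by
    rw [hq]; unfold Function.uncurry; fun_prop
  have hQ : ∀ y ∈ Set.Ioo (0:ℝ) 1, ∀ s ∈ Set.Ioo (0:ℝ) 1,
      QQ (a₃ + (b₃ - a₃) - a₁) (b₁ - a₁) (b₃ - a₃) (y * (1 - s)) =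
        ENNReal.ofReal (ProbabilityTheory.beta (b₁ - a₁) (b₃ - a₃) *
          F21 (b₃ - a₁) (b₁ - a₁) (b₁ + b₃ - a₁ - a₃) (y * (1 - s))) := by
    intro y hy s hs
    unfold QQ wt
    rw [aux_euler_lint _ _ _ _ hc₁ hc₃ (mul_nonneg hy.1.le (by linarith [hs.2]))
      (by nlinarith [hy.1, hy.2, hs.1, hs.2]),
      show a₃ + (b₃ - a₃) - a₁ = b₃ - a₁ by ring,
      show b₁ - a₁ + (b₃ - a₃) = b₁ + b₃ - a₁ - a₃ by ring]
  have hqt : ∀ y ∈ Set.Ioo (0:ℝ) 1, ∀ s ∈ Set.Ioo (0:ℝ) 1, q y s < ⊤ := by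
    intro y hy s hs
    simp only [hq]
    rw [hQ y hy s hs]
    exact ENNReal.mul_lt_top ENNReal.ofReal_lt_top ENNReal.ofReal_lt_top
  have hqr : ∀ y ∈ Set.Ioo (0:ℝ) 1, ∀ s ∈ Set.Ioo (0:ℝ) 1,
      s ^ (a₂ - 1) * y ^ (b₁ + b₃ - a₁ - a₃ - 1) *
            (1 - s) ^ (b₁ + b₂ + b₃ - a₁ - a₂ - a₃ - 1) * (1 - y) ^ (b₂ - a₂ - 1) *
            (1 + s * x) ^ (-σ) * (1 - y * (1 - s)) ^ (-(b₂ - a₃)) *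
            F21 (b₃ - a₁) (b₁ - a₁) (b₁ + b₃ - a₁ - a₃) (y * (1 - s)) =
      (ProbabilityTheory.beta (b₁ - a₁) (b₃ - a₃))⁻¹ * (q y s).toReal := by
    intro y hy s hs
    simp only [hq]
    rw [hQ y hy s hs, ENNReal.toReal_mul]
    have hz0 : 0 ≤ y * (1 - s) := mul_nonneg hy.1.le (by linarith [hs.2])
    have hz1 : y * (1 - s) < 1 := by nlinarith [hy.1, hy.2, hs.1, hs.2]
    have hF := F21_nonneg (b₃ - a₁) (b₁ - a₁) (b₃ - a₃) (y * (1 - s)) hc₁ hc₃ hz0 hz1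
    rw [show b₁ - a₁ + (b₃ - a₃) = b₁ + b₃ - a₁ - a₃ by ring] at hF ⊢
    have i1 : 0 ≤ s := hs.1.le
    have i2 : 0 ≤ 1 - s := by linarith [hs.2]
    have i3 : 0 ≤ y := hy.1.le
    have i4 : 0 ≤ 1 - y := by linarith [hy.2]
    have i5 : 0 ≤ 1 - y * (1 - s) := by linarith
    have i6 : 0 ≤ 1 + s * x := by nlinarith [hs.1, hs.2]
    rw [ENNReal.toReal_ofReal (by positivity), ENNReal.toReal_ofReal (by positivity),
      show b₁ + b₃ - a₁ - a₃ + (b₂ - a₂) - 1 = b₁ + b₂ + b₃ - a₁ - a₂ - a₃ - 1 by ring,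
      show a₃ - a₂ - (b₂ - a₂) = -(b₂ - a₃) by ring]
    field_simp
  have hint : ∫ y in Set.Ioo (0 : ℝ) 1, ∫ s in Set.Ioo (0 : ℝ) 1,
          s ^ (a₂ - 1) * y ^ (b₁ + b₃ - a₁ - a₃ - 1) *
            (1 - s) ^ (b₁ + b₂ + b₃ - a₁ - a₂ - a₃ - 1) * (1 - y) ^ (b₂ - a₂ - 1) *
            (1 + s * x) ^ (-σ) * (1 - y * (1 - s)) ^ (-(b₂ - a₃)) *
            F21 (b₃ - a₁) (b₁ - a₁) (b₁ + b₃ - a₁ - a₃) (y * (1 - s)) =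
      (ProbabilityTheory.beta (b₁ - a₁) (b₃ - a₃))⁻¹ *
        (LL σ x a₁ a₂ a₃ (b₁ - a₁) (b₂ - a₂) (b₃ - a₃)).toReal := by
    have hin : ∀ y ∈ Set.Ioo (0:ℝ) 1, ∫ s in Set.Ioo (0 : ℝ) 1,
          s ^ (a₂ - 1) * y ^ (b₁ + b₃ - a₁ - a₃ - 1) *
            (1 - s) ^ (b₁ + b₂ + b₃ - a₁ - a₂ - a₃ - 1) * (1 - y) ^ (b₂ - a₂ - 1) *
            (1 + s * x) ^ (-σ) * (1 - y * (1 - s)) ^ (-(b₂ - a₃)) *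
            F21 (b₃ - a₁) (b₁ - a₁) (b₁ + b₃ - a₁ - a₃) (y * (1 - s)) =
        (ProbabilityTheory.beta (b₁ - a₁) (b₃ - a₃))⁻¹ *
          (∫⁻ s in Set.Ioo (0:ℝ) 1, q y s).toReal := by
      intro y hy
      rw [setIntegral_congr_fun measurableSet_Ioo (fun s hs => hqr y hy s hs),
        integral_const_mul, integral_toReal]
      · exact (hqm.comp measurable_prodMk_left).aemeasurable
      · filter_upwards [ae_restrict_mem measurableSet_Ioo] with s hs using hqt y hy s hs
    have hm2 : Measurable fun y => ∫⁻ s in Set.Ioo (0:ℝ) 1, q y s :=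
      Measurable.lintegral_prod_right' hqm
    rw [setIntegral_congr_fun measurableSet_Ioo hin, integral_const_mul, integral_toReal
      hm2.aemeasurable, hLL]
    refine ae_lt_top hm2 ?_
    rw [← hLL]; exact hfin.ne
  rw [hint, hypF_eq σ x a₁ a₂ a₃ b₁ b₂ b₃ hx]
  unfold ProbabilityTheory.beta
  rw [show b₁ - a₁ + (b₃ - a₃) = b₁ + b₃ - a₁ - a₃ by ring]
  have g1 := Gamma_pos_of_pos hc₁
  have g2 := Gamma_pos_of_pos hc₂
  have g3 := Gamma_pos_of_pos hc₃
  have g4 := Gamma_pos_of_pos h₁.1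
  have g5 := Gamma_pos_of_pos h₂.1
  have g6 := Gamma_pos_of_pos h₃.1
  have g7 := Gamma_pos_of_pos (show 0 < b₁ + b₃ - a₁ - a₃ by linarith)
  field_simp
end
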